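/- Let (f_n)_{n∈ℕ} be a sequence of non-increasing functions from ℝ to ℝ ∪ {∞} converging pointwise to a function f, and let t ∈ ℝ be a point at which f is right-continuous (lim_{s→t⁺} f(s) = f(t)). Then lim_{β→0⁺} liminf_{n→∞} inf{ f_n(s) : |t - s| < β } = lim_{β→0⁺} limsup_{n→∞} inf{ f_n(s) : |t - s| < β } = f(t); that is, (f_n) converges infimally to f at t in the sense of Wijsman. -/

import Mathlib

open Filter Set Topology

/-- if a sequence `f n : ℝ → ℝ ∪ {∞}` of non-increasing functions
converges pointwise to `g`, and `g` is right-continuous at `t`, then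
`lim_{β → 0⁺} liminf_n inf {f n s : |t - s| < β}
  = lim_{β → 0⁺} limsup_n inf {f n s : |t - s| < β} = g t`,
i.e. `(f n)` converges infimally to `g` at `t` in the sense of Wijsman. -/
theorem statement_17 (f : ℕ → ℝ → EReal) (g : ℝ → EReal)
    (hne : ∀ n s, f n s ≠ ⊥) (hgne : ∀ s, g s ≠ ⊥)
    (hanti : ∀ n, Antitone (f n))
    (hlim : ∀ s : ℝ, Tendsto (fun n => f n s) atTop (𝓝 (g s)))
    (t : ℝ) (hrc : Tendsto g (𝓝[>] t) (𝓝 (g t))) :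
    Tendsto
        (fun β : ℝ =>
          Filter.liminf (fun n => ⨅ s ∈ Set.Ioo (t - β) (t + β), f n s) atTop)
        (𝓝[>] (0 : ℝ)) (𝓝 (g t)) ∧
      Tendsto
        (fun β : ℝ =>
          Filter.limsup (fun n => ⨅ s ∈ Set.Ioo (t - β) (t + β), f n s) atTop)
        (𝓝[>] (0 : ℝ)) (𝓝 (g t)) := by
  have hsh : Tendsto (fun β : ℝ => g (t + β)) (𝓝[>] (0 : ℝ)) (𝓝 (g t)) := by
    refine hrc.comp (tendsto_nhdsWithin_iff.2 ⟨?_, ?_⟩)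
    · have h : Tendsto (fun β : ℝ => t + β) (𝓝 0) (𝓝 (t + 0)) :=
        (continuous_const.add continuous_id).tendsto 0
      rw [add_zero] at h
      exact h.mono_left nhdsWithin_le_nhds
    · filter_upwards [self_mem_nhdsWithin] with β hβ
      have : (0 : ℝ) < β := hβ
      simpa using this
  have hlow : ∀ β : ℝ, g (t + β) ≤
      Filter.liminf (fun n => ⨅ s ∈ Set.Ioo (t - β) (t + β), f n s) atTop := by
    intro β
    rw [← (hlim (t + β)).liminf_eq]
    refine Filter.liminf_le_liminf (Eventually.of_forall fun n => ?_)
    exact le_iInf₂ fun s hs => hanti n hs.2.le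
  have hup : ∀ β : ℝ, 0 < β →
      Filter.limsup (fun n => ⨅ s ∈ Set.Ioo (t - β) (t + β), f n s) atTop ≤ g t := by
    intro β hβ
    rw [← (hlim t).limsup_eq]
    refine Filter.limsup_le_limsup (Eventually.of_forall fun n => ?_)
    exact iInf₂_le t ⟨by linarith, by linarith⟩
  have hmid : ∀ β : ℝ,
      Filter.liminf (fun n => ⨅ s ∈ Set.Ioo (t - β) (t + β), f n s) atTop ≤
      Filter.limsup (fun n => ⨅ s ∈ Set.Ioo (t - β) (t + β), f n s) atTop :=
    fun β => Filter.liminf_le_limsup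
  constructor
  · refine tendsto_of_tendsto_of_tendsto_of_le_of_le' hsh tendsto_const_nhds
      (Eventually.of_forall hlow) ?_
    filter_upwards [self_mem_nhdsWithin] with β hβ
    exact (hmid β).trans (hup β hβ)
  · refine tendsto_of_tendsto_of_tendsto_of_le_of_le' hsh tendsto_const_nhds
      (Eventually.of_forall fun β => (hlow β).trans (hmid β)) ?_
    filter_upwards [self_mem_nhdsWithin] with β hβ
    exact hup β hβ
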